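/- Let n ≥ 5 and 3 ≤ l ≤ n−2. Let R_l := K[x_{n−l−1}, x_{n−l}, x_{n−l+1}, x_{n−l+2}, …, x_n, z_{n−l−1}, z_{n−l}, z_{n−l+1}, z_{n−l+2}, …, z_n, y_{n−l−1}] be a polynomial ring in 2l+5 variables, and let L_l ⊂ R_l be the monomial ideal generated by the path edges x_{n−l+2}x_{n−l+3}, x_{n−l+3}x_{n−l+4}, …, x_{n−1}x_n, the path edges z_{n−l+2}z_{n−l+3}, z_{n−l+3}z_{n−l+4}, …, z_{n−1}z_n, and the seven variables x_{n−l}, z_{n−l}, x_{n−l+1}, y_{n−l−1}, z_{n−l+1}, x_{n−l−1}, z_{n−l−1}. Then sdepth_{R_l}(L_l) ≥ ⌈(l+2)/3⌉ + 1. -/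

import Mathlib

open MvPolynomial

section Defs

variable (K : Type) [Field K] (σ : Type)
variable (M : Type) [AddCommGroup M] [Module K M] [Module (MvPolynomial σ K) M]
  [IsScalarTower K (MvPolynomial σ K) M]

/-- The Stanley space `w K[A]`: the `K`-span of `{u • w : u a monomial in the variables of A}`. -/
noncomputable def stanleySpace (w : M) (A : Finset σ) : Submodule K M :=
  Submodule.span K { m | ∃ u : σ →₀ ℕ, (↑u.support : Set σ) ⊆ ↑A ∧
    m = (monomial u (1 : K) : MvPolynomial σ K) • w }

/-- `(w, A)` indexed by `Fin r` gives a Stanley decomposition of `M`: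
each Stanley space `wᵢ K[Aᵢ]` is a free `K[Aᵢ]`-module and `M` is their internal direct
sum as a `K`-vector space. -/
def IsStanleyDecomp {r : ℕ} (w : Fin r → M) (A : Fin r → Finset σ) : Prop :=
  (∀ i (f : MvPolynomial σ K), (↑f.vars : Set σ) ⊆ ↑(A i) → f • w i = 0 → f = 0) ∧
  (iSupIndep fun i => stanleySpace K σ M (w i) (A i)) ∧
  (⨆ i, stanleySpace K σ M (w i) (A i)) = ⊤

/-- The Stanley depth of `M`: the largest value of `minᵢ |Aᵢ|` over all Stanley
decompositions of `M`. -/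
noncomputable def sdepth : ℕ :=
  sSup { d | ∃ r, ∃ w : Fin r → M, ∃ A : Fin r → Finset σ,
    IsStanleyDecomp K σ M w A ∧ d = sInf (Set.range fun i => (A i).card) }

/-- The depth of `M` with respect to the maximal graded ideal `(x₁, …, x_N)`:
the maximal length of an `M`-regular sequence of elements of that ideal. -/
noncomputable def rdepth : ℕ :=
  sSup { d | ∃ rs : List (MvPolynomial σ K), rs.length = d ∧
    (∀ f ∈ rs, f ∈ Ideal.span (Set.range (X : σ → MvPolynomial σ K))) ∧
    RingTheory.Sequence.IsRegular M rs }

end Defs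

/-- Adjacency in the strong product `Pₙ ⊠ Pₘ` (vertices `(i,j)`, `0`-indexed): distinct
vertices are adjacent iff both coordinates differ by at most `1`. -/
def pAdj (n m : ℕ) (a b : Fin n × Fin m) : Prop :=
  a ≠ b ∧ |((a.1 : ℤ) - (b.1 : ℤ))| ≤ 1 ∧ |((a.2 : ℤ) - (b.2 : ℤ))| ≤ 1

/-- Adjacency in the strong product `Cₙ ⊠ Pₘ` (vertices `(i,j)`, `0`-indexed). -/
def cAdj (n m : ℕ) (a b : Fin n × Fin m) : Prop :=
  a ≠ b ∧ min ((a.1 : ℤ) - (b.1 : ℤ)).natAbs (n - ((a.1 : ℤ) - (b.1 : ℤ)).natAbs) ≤ 1 ∧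
    |((a.2 : ℤ) - (b.2 : ℤ))| ≤ 1

/-- The edge ideal of the graph with vertex set `V` and adjacency relation `Adj`. -/
noncomputable def edgeIdeal (K : Type) [Field K] {V : Type} (Adj : V → V → Prop) :
    Ideal (MvPolynomial V K) :=
  Ideal.span { p | ∃ a b : V, Adj a b ∧ p = X a * X b }

/-- The variables of the ring `R_l`: `x_k` and `z_k` for `n−l−1 ≤ k ≤ n` (the pairs
`(k, 0)` and `(k, 1)` respectively), together with the single variable `y_{n−l−1}`. -/
def RlVars (n l : ℕ) : Type :=
  ({k : ℕ // n - l - 1 ≤ k ∧ k ≤ n} × Fin 2) ⊕ Unit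

/-- The monomial ideal `L_l ⊂ R_l`, generated by the path edges
`x_{n−l+2}x_{n−l+3}, …, x_{n−1}x_n`, the path edges `z_{n−l+2}z_{n−l+3}, …, z_{n−1}z_n`,
and the seven variables `x_{n−l}, z_{n−l}, x_{n−l+1}, y_{n−l−1}, z_{n−l+1}, x_{n−l−1},
z_{n−l−1}`. -/
noncomputable def Ll (K : Type) [Field K] (n l : ℕ) : Ideal (MvPolynomial (RlVars n l) K) :=
  Ideal.span
    ({ p | ∃ a b : {k : ℕ // n - l - 1 ≤ k ∧ k ≤ n}, (b : ℕ) = (a : ℕ) + 1 ∧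
        n - l + 2 ≤ (a : ℕ) ∧
        (p = X (Sum.inl (a, (0 : Fin 2))) * X (Sum.inl (b, (0 : Fin 2))) ∨
          p = X (Sum.inl (a, (1 : Fin 2))) * X (Sum.inl (b, (1 : Fin 2)))) } ∪
      { p | ∃ a : {k : ℕ // n - l - 1 ≤ k ∧ k ≤ n},
          ((a : ℕ) = n - l - 1 ∨ (a : ℕ) = n - l ∨ (a : ℕ) = n - l + 1) ∧
          (p = X (Sum.inl (a, (0 : Fin 2))) ∨ p = X (Sum.inl (a, (1 : Fin 2)))) } ∪
      {X (Sum.inr ())})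

def PInd (T : Finset ℕ) : Prop := ∀ i ∈ T, i + 1 ∉ T

lemma path_part (k : ℕ) : ∃ lo hi : Finset ℕ → Finset ℕ, ∀ s, s ⊆ Finset.range k → PInd s →
    lo s ⊆ s ∧ s ⊆ hi s ∧ hi s ⊆ Finset.range k ∧ PInd (hi s) ∧ (k + 2) / 3 ≤ (hi s).card ∧
    ∀ t, lo s ⊆ t → t ⊆ hi s → lo t = lo s ∧ hi t = hi s := by
  induction k using Nat.strong_induction_on with
  | _ k ih =>
  match k with
  | 0 =>
    refine ⟨fun _ => ∅, fun _ => ∅, fun s hs _ => ?_⟩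
    have : s = ∅ := by simpa using hs
    subst this
    simp [PInd]
  | 1 =>
    refine ⟨fun _ => ∅, fun _ => {0}, fun s hs _ => ?_⟩
    simp only [Finset.range_one] at *
    simp [PInd, hs]
  | j + 2 =>
    obtain ⟨lo1, hi1, h1⟩ := ih (j - 1) (by omega)
    obtain ⟨lo2, hi2, h2⟩ := ih j (by omega)
    refine ⟨fun s => if j ∈ s then insert j (lo1 (s.erase j)) else lo2 (s.erase (j+1)),
      fun s => if j ∈ s then insert j (hi1 (s.erase j)) else insert (j+1) (hi2 (s.erase (j+1))),
      fun s hs hI => ?_⟩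
    by_cases hj : j ∈ s
    · simp only [hj, if_true]
      obtain ⟨a1, a2, a3, a4, a5, a6⟩ := h1 (s.erase j) (by
        intro i hi
        simp only [Finset.mem_erase, Finset.mem_range] at *
        have := Finset.mem_range.1 (hs hi.2)
        have h3 := hI j hj
        have h4 : i ≠ j + 1 := by rintro rfl; exact h3 hi.2
        have h5 : i + 1 ≠ j := by rintro rfl; exact hI i hi.2 hj
        omega) (by
        intro i hi h
        exact hI i (Finset.mem_of_mem_erase hi) (Finset.mem_of_mem_erase h))
      have hjn : j ∉ hi1 (s.erase j) := fun h => by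
        have := Finset.mem_range.1 (a3 h); omega
      refine ⟨?_, ?_, ?_, ?_, ?_, ?_⟩
      · intro i hi
        rcases Finset.mem_insert.1 hi with rfl | hi
        · exact hj
        · exact Finset.mem_of_mem_erase (a1 hi)
      · intro i hi
        by_cases h : i = j
        · simp [h]
        · exact Finset.mem_insert_of_mem (a2 (Finset.mem_erase.2 ⟨h, hi⟩))
      · intro i hi
        rcases Finset.mem_insert.1 hi with rfl | hi
        · simp
        · have := Finset.mem_range.1 (a3 hi)
          exact Finset.mem_range.2 (by omega)
      · intro i hi h
        rcases Finset.mem_insert.1 hi with rfl | hi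
        · rcases Finset.mem_insert.1 h with h | h
          · omega
          · have := Finset.mem_range.1 (a3 h); omega
        · have := Finset.mem_range.1 (a3 hi)
          rcases Finset.mem_insert.1 h with h | h
          · omega
          · exact a4 i hi h
      · rw [Finset.card_insert_of_notMem hjn]; omega
      · intro t ht1 ht2
        have hjt : j ∈ t := ht1 (by simp)
        obtain ⟨e1, e2⟩ := a6 (t.erase j) (by
          intro i hi
          refine Finset.mem_erase.2 ⟨?_, ht1 (Finset.mem_insert_of_mem hi)⟩
          rintro rfl
          exact absurd (a1 hi) (by simp)) (by
          intro i hi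
          have h := Finset.mem_erase.1 hi
          exact (Finset.mem_insert.1 (ht2 h.2)).resolve_left h.1)
        simp [hjt, e1, e2]
    · simp only [hj, if_false]
      obtain ⟨a1, a2, a3, a4, a5, a6⟩ := h2 (s.erase (j+1)) (by
        intro i hi
        simp only [Finset.mem_erase, Finset.mem_range] at *
        have := Finset.mem_range.1 (hs hi.2)
        have h5 : i ≠ j := by rintro rfl; exact hj hi.2
        omega) (by
        intro i hi h
        exact hI i (Finset.mem_of_mem_erase hi) (Finset.mem_of_mem_erase h))
      have hjn : j + 1 ∉ hi2 (s.erase (j+1)) := fun h => by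
        have := Finset.mem_range.1 (a3 h); omega
      refine ⟨?_, ?_, ?_, ?_, ?_, ?_⟩
      · intro i hi
        exact Finset.mem_of_mem_erase (a1 hi)
      · intro i hi
        by_cases h : i = j + 1
        · simp [h]
        · exact Finset.mem_insert_of_mem (a2 (Finset.mem_erase.2 ⟨h, hi⟩))
      · intro i hi
        rcases Finset.mem_insert.1 hi with rfl | hi
        · simp
        · have := Finset.mem_range.1 (a3 hi)
          exact Finset.mem_range.2 (by omega)
      · intro i hi h
        rcases Finset.mem_insert.1 hi with rfl | hi
        · rcases Finset.mem_insert.1 h with h | h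
          · omega
          · have := Finset.mem_range.1 (a3 h); omega
        · have := Finset.mem_range.1 (a3 hi)
          rcases Finset.mem_insert.1 h with h | h
          · omega
          · exact a4 i hi h
      · rw [Finset.card_insert_of_notMem hjn]; omega
      · intro t ht1 ht2
        have hjt : j ∉ t := by
          intro h
          rcases Finset.mem_insert.1 (ht2 h) with h | h
          · omega
          · have := Finset.mem_range.1 (a3 h); omega
        obtain ⟨e1, e2⟩ := a6 (t.erase (j+1)) (by
          intro i hi
          refine Finset.mem_erase.2 ⟨?_, ht1 hi⟩
          rintro rfl
          exact absurd (a1 hi) (by simp)) (by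
          intro i hi
          have h := Finset.mem_erase.1 hi
          exact (Finset.mem_insert.1 (ht2 h.2)).resolve_left h.1)
        simp [hjt, e1, e2]

open Classical in
lemma union_part {σ : Type} [Fintype σ] (m : ℕ) (hm : 2 ≤ m) (x z : ℕ → σ)
    (hx : ∀ i < m, ∀ j < m, x i = x j → i = j) (hz : ∀ i < m, ∀ j < m, z i = z j → i = j)
    (hxz : ∀ i < m, ∀ j < m, x i ≠ z j) (P : Finset σ → Prop)
    (hP : ∀ s, P s ↔ (∃ v ∈ s, (∀ i < m, v ≠ x i) ∧ (∀ i < m, v ≠ z i)) ∨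
      (∃ i, i + 1 < m ∧ x i ∈ s ∧ x (i+1) ∈ s) ∨ (∃ i, i + 1 < m ∧ z i ∈ s ∧ z (i+1) ∈ s)) :
    ∃ lo hi : Finset σ → Finset σ, ∀ s, P s → lo s ⊆ s ∧ s ⊆ hi s ∧ (m + 2) / 3 + 2 ≤ (hi s).card ∧
    ∀ t, lo s ⊆ t → t ⊆ hi s → P t ∧ lo t = lo s ∧ hi t = hi s := by
  obtain ⟨lo, hi, h⟩ := path_part m
  obtain ⟨XX, hXX⟩ : ∃ XX, XX = (Finset.range m).image x := ⟨_, rfl⟩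
  obtain ⟨ZZ, hZZ⟩ : ∃ ZZ, ZZ = (Finset.range m).image z := ⟨_, rfl⟩
  have mX : ∀ v, v ∈ XX ↔ ∃ i < m, x i = v := by simp [hXX]
  have mZ : ∀ v, v ∈ ZZ ↔ ∃ i < m, z i = v := by simp [hZZ]
  have cX : XX.card = m := by
    rw [hXX, Finset.card_image_of_injOn, Finset.card_range]
    intro i hi j hj; simp at hi hj; exact hx i hi j hj
  have cZ : ZZ.card = m := by
    rw [hZZ, Finset.card_image_of_injOn, Finset.card_range]
    intro i hi j hj; simp at hi hj; exact hz i hi j hj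
  have dXZ : Disjoint XX ZZ := by
    rw [Finset.disjoint_left]; intro v h1 h2
    obtain ⟨i, hi, rfl⟩ := (mX v).1 h1
    obtain ⟨j, hj, e⟩ := (mZ _).1 h2
    exact hxz i hi j hj e.symm
  have nXZ : ∀ v, v ∈ XX → v ∉ ZZ := fun v h => Finset.disjoint_left.1 dXZ h
  obtain ⟨V, hV⟩ : ∃ V, V = (XX ∪ ZZ)ᶜ := ⟨_, rfl⟩
  have mV : ∀ v, v ∈ V ↔ v ∉ XX ∧ v ∉ ZZ := by simp [hV]
  obtain ⟨xs, hxs⟩ : ∃ xs : Finset σ → Finset ℕ,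
    ∀ s i, i ∈ xs s ↔ i < m ∧ x i ∈ s := ⟨fun s => (Finset.range m).filter (x · ∈ s), by simp⟩
  have hxsr : ∀ s, xs s ⊆ Finset.range m := fun s i hi => by simpa using ((hxs s i).1 hi).1
  have hP' : ∀ s, P s ↔ (s ∩ V).Nonempty ∨ ¬ PInd (xs s) ∨
      (∃ i, i + 1 < m ∧ z i ∈ s ∧ z (i+1) ∈ s) := by
    intro s
    rw [hP]
    refine or_congr ?_ (or_congr ?_ Iff.rfl)
    · constructor
      · rintro ⟨v, h1, h2, h3⟩
        refine ⟨v, Finset.mem_inter.2 ⟨h1, (mV v).2 ⟨?_, ?_⟩⟩⟩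
        · rw [mX]; rintro ⟨i, hi, e⟩; exact h2 i hi e.symm
        · rw [mZ]; rintro ⟨i, hi, e⟩; exact h3 i hi e.symm
      · rintro ⟨v, hv⟩
        obtain ⟨h1, h2⟩ := Finset.mem_inter.1 hv
        rw [mV, mX, mZ] at h2
        exact ⟨v, h1, fun i hi e => h2.1 ⟨i, hi, e.symm⟩, fun i hi e => h2.2 ⟨i, hi, e.symm⟩⟩
    · simp only [PInd, hxs]
      push Not
      constructor
      · rintro ⟨i, h1, h2, h3⟩; exact ⟨i, ⟨by omega, h2⟩, h1, h3⟩
      · rintro ⟨i, ⟨h1, h2⟩, h3, h4⟩; exact ⟨i, h3, h2, h4⟩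
  have two : ∀ (s : Finset σ) (a b : σ), a ≠ b → a ∈ s → b ∈ s → 2 ≤ s.card := by
    intro s a b hab ha hb
    exact Finset.one_lt_card.2 ⟨a, ha, b, hb, hab⟩
  refine ⟨fun s => if (s ∩ V).Nonempty then s ∩ V else if ¬ PInd (xs s) then s ∩ XX else
      (lo (xs s)).image x ∪ (s ∩ ZZ),
    fun s => if (s ∩ V).Nonempty then (s ∩ V) ∪ (XX ∪ ZZ) else
      if ¬ PInd (xs s) then s ∩ XX ∪ ZZ else (hi (xs s)).image x ∪ (s ∩ ZZ), fun s hs => ?_⟩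
  by_cases c1 : (s ∩ V).Nonempty
  · simp only [c1, if_true]
    refine ⟨Finset.inter_subset_left, ?_, ?_, ?_⟩
    · intro v hv
      have := mV v
      simp only [Finset.mem_union, Finset.mem_inter]
      tauto
    · have : Disjoint (s ∩ V) (XX ∪ ZZ) := by
        rw [Finset.disjoint_left]
        intro v
        have := mV v
        simp only [Finset.mem_union, Finset.mem_inter]
        tauto
      rw [Finset.card_union_of_disjoint this, Finset.card_union_of_disjoint dXZ]
      have := c1.card_pos
      omega
    · intro t h1 h2
      have e : t ∩ V = s ∩ V := by
        ext v
        have a1 := @h1 v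
        have a2 := @h2 v
        have := mV v
        simp only [Finset.mem_union, Finset.mem_inter] at *
        tauto
      refine ⟨(hP' t).2 (Or.inl (e ▸ c1)), ?_⟩
      simp [e, c1]
  · simp only [c1, if_false]
    have sV : ∀ v ∈ s, v ∉ V := fun v h1 h2 => c1 ⟨v, Finset.mem_inter.2 ⟨h1, h2⟩⟩
    by_cases c2 : PInd (xs s)
    · simp only [c2, not_true, if_false]
      obtain ⟨i, i1, i2, i3⟩ : ∃ i, i + 1 < m ∧ z i ∈ s ∧ z (i+1) ∈ s := by
        have := (hP' s).1 hs
        tauto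
      have i4 : z i ∈ ZZ := (mZ _).2 ⟨i, by omega, rfl⟩
      have i5 : z (i+1) ∈ ZZ := (mZ _).2 ⟨i+1, by omega, rfl⟩
      obtain ⟨a1, a2, a3, a4, a5, a6⟩ := h (xs s) (hxsr s) c2
      have hsub : (hi (xs s)).image x ⊆ XX := by
        rw [hXX]; exact Finset.image_subset_image a3
      have hlX : (lo (xs s)).image x ⊆ XX :=
        (Finset.image_subset_image (a1.trans a2)).trans hsub
      refine ⟨?_, ?_, ?_, ?_⟩
      · apply Finset.union_subset _ Finset.inter_subset_left
        intro v hv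
        obtain ⟨i, hi, rfl⟩ := Finset.mem_image.1 hv
        exact ((hxs _ _).1 (a1 hi)).2
      · intro v hv
        have := sV v hv
        rw [mV] at this
        by_cases vz : v ∈ ZZ
        · exact Finset.mem_union_right _ (Finset.mem_inter.2 ⟨hv, vz⟩)
        · have vx : v ∈ XX := by tauto
          obtain ⟨i, hi, rfl⟩ := (mX v).1 vx
          exact Finset.mem_union_left _ (Finset.mem_image_of_mem _ (a2 ((hxs _ _).2 ⟨hi, hv⟩)))
      · have d : Disjoint ((hi (xs s)).image x) (s ∩ ZZ) :=
          Finset.disjoint_of_subset_left hsub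
            (Finset.disjoint_of_subset_right Finset.inter_subset_right dXZ)
        rw [Finset.card_union_of_disjoint d, Finset.card_image_of_injOn]
        · have := two (s ∩ ZZ) _ _ (fun e => by
            have := hz i (by omega) (i+1) i1 e; omega)
            (Finset.mem_inter.2 ⟨i2, i4⟩) (Finset.mem_inter.2 ⟨i3, i5⟩)
          omega
        · intro i hi j hj
          have := Finset.mem_range.1 (a3 hi)
          have := Finset.mem_range.1 (a3 hj)
          apply hx <;> assumption
      · intro t h1 h2
        have e1 : ¬ (t ∩ V).Nonempty := by
          rintro ⟨v, hv⟩
          have a2 := @h2 v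
          have := mV v
          have := @hsub v
          simp only [Finset.mem_union, Finset.mem_inter] at *
          tauto
        have e2 : t ∩ ZZ = s ∩ ZZ := by
          ext v
          have a1 := @h1 v
          have a2 := @h2 v
          have := @hsub v
          have := nXZ v
          simp only [Finset.mem_union, Finset.mem_inter] at *
          tauto
        have e3 : lo (xs s) ⊆ xs t := by
          intro i hi
          exact (hxs _ _).2 ⟨((hxs _ _).1 (a1 hi)).1,
            h1 (Finset.mem_union_left _ (Finset.mem_image_of_mem _ hi))⟩
        have e4 : xs t ⊆ hi (xs s) := by
          intro i hi
          obtain ⟨b1, b2⟩ := (hxs _ _).1 hi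
          rcases Finset.mem_union.1 (h2 b2) with b | b
          · obtain ⟨j, hj, e⟩ := Finset.mem_image.1 b
            have := hx _ (Finset.mem_range.1 (a3 hj)) _ b1 e
            exact this ▸ hj
          · exact absurd (Finset.mem_inter.1 b).2 (nXZ _ ((mX _).2 ⟨i, b1, rfl⟩))
        have e5 : PInd (xs t) := fun i hi hj => a4 i (e4 hi) (e4 hj)
        obtain ⟨e6, e7⟩ := a6 _ e3 e4
        refine ⟨(hP' t).2 (Or.inr (Or.inr ⟨i, i1, ?_, ?_⟩)), ?_⟩
        · exact (Finset.mem_inter.1 (e2.symm ▸ Finset.mem_inter.2 ⟨i2, i4⟩ : z i ∈ t ∩ ZZ)).1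
        · exact (Finset.mem_inter.1 (e2.symm ▸ Finset.mem_inter.2 ⟨i3, i5⟩ : z (i+1) ∈ t ∩ ZZ)).1
        · simp [e1, e2, e5, e6, e7]
    · simp only [c2, not_false_iff, if_true]
      refine ⟨Finset.inter_subset_left, ?_, ?_, ?_⟩
      · intro v hv
        have := sV v hv
        rw [mV] at this
        simp only [Finset.mem_union, Finset.mem_inter]
        tauto
      · rw [Finset.card_union_of_disjoint
          (Finset.disjoint_of_subset_left Finset.inter_subset_right dXZ)]
        have : 2 ≤ (s ∩ XX).card := by
          unfold PInd at c2
          push Not at c2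
          obtain ⟨i, h1, h2⟩ := c2
          rw [hxs] at h1 h2
          exact two _ _ _ (fun e => by have := hx i (by omega) (i+1) h2.1 e; omega)
            (Finset.mem_inter.2 ⟨h1.2, (mX _).2 ⟨i, h1.1, rfl⟩⟩)
            (Finset.mem_inter.2 ⟨h2.2, (mX _).2 ⟨_, h2.1, rfl⟩⟩)
        omega
      · intro t h1 h2
        have e1 : ¬ (t ∩ V).Nonempty := by
          rintro ⟨v, hv⟩
          have a2 := @h2 v
          have := mV v
          simp only [Finset.mem_union, Finset.mem_inter] at *
          tauto
        have e2 : t ∩ XX = s ∩ XX := by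
          ext v
          have a1 := @h1 v
          have a2 := @h2 v
          have := nXZ v
          simp only [Finset.mem_union, Finset.mem_inter] at *
          tauto
        have e3 : xs t = xs s := by
          ext i
          rw [hxs, hxs]
          refine and_congr_right fun hi => ?_
          have : x i ∈ XX := (mX _).2 ⟨i, hi, rfl⟩
          have e : x i ∈ t ∩ XX ↔ x i ∈ s ∩ XX := by rw [e2]
          simp only [Finset.mem_inter] at e
          tauto
        refine ⟨(hP' t).2 (Or.inr (Or.inl (e3 ▸ c2))), ?_⟩
        simp [e1, e2, e3, c2]

lemma sdepth_ge_aux {K : Type} [Field K] {σ : Type} [Fintype σ] (I : Ideal (MvPolynomial σ K))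
    (P : Finset σ → Prop) (hPne : ∃ s, P s)
    (hI1 : ∀ u : σ →₀ ℕ, P u.support → (monomial u (1 : K)) ∈ I)
    (hI2 : ∀ f ∈ I, ∀ u ∈ f.support, P u.support)
    (lo hi : Finset σ → Finset σ) (d : ℕ)
    (h : ∀ s, P s → lo s ⊆ s ∧ s ⊆ hi s ∧ d ≤ (hi s).card ∧
      ∀ t, lo s ⊆ t → t ⊆ hi s → P t ∧ lo t = lo s ∧ hi t = hi s) :
    d ≤ sdepth K σ I := by
  classical
  let J := {F : Finset σ // P F ∧ lo F = F}
  have hJ : ∀ s, P s → P (lo s) ∧ lo (lo s) = lo s ∧ hi (lo s) = hi s := fun s hs =>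
    (h s hs).2.2.2 (lo s) subset_rfl ((h s hs).1.trans (h s hs).2.1)
  let ind : Finset σ → (σ →₀ ℕ) := fun F => Finsupp.indicator F (fun _ _ => 1)
  have indap : ∀ F i, ind F i = if i ∈ F then 1 else 0 := by
    intro F i; simp [ind, Finsupp.indicator_apply]
  have indsupp : ∀ F, (ind F).support = F := by
    intro F; ext i; simp [indap]
  let r := Fintype.card J
  let e : Fin r ≃ J := (Fintype.equivFin J).symm
  let w : Fin r → I := fun i => ⟨monomial (ind (e i).1) 1, hI1 _ (by rw [indsupp]; exact (e i).2.1)⟩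
  let A : Fin r → Finset σ := fun i => hi (e i).1
  let S : Fin r → Set (σ →₀ ℕ) := fun i => {u | (e i).1 ⊆ u.support ∧ u.support ⊆ hi (e i).1}
  let D : Set (σ →₀ ℕ) → Submodule K I := fun T =>
    Submodule.comap (I.subtype.restrictScalars K) (restrictSupport K T)
  have hD : ∀ T (f : I), f ∈ D T ↔ ∀ u ∈ f.1.support, u ∈ T := fun T f => Iff.rfl
  have hle : ∀ i, stanleySpace K σ I (w i) (A i) ≤ D (S i) := by
    intro i
    refine Submodule.span_le.2 ?_
    rintro m ⟨u, hu, rfl⟩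
    rw [SetLike.mem_coe, hD]
    intro v hv
    have e1 : ((monomial u (1 : K) : MvPolynomial σ K) • w i).1 =
        monomial (u + ind (e i).1) 1 := by
      simp [w, monomial_mul]
    rw [e1] at hv
    have := support_monomial_subset hv
    rw [Finset.mem_singleton] at this
    subst this
    have es : (u + ind (e i).1).support = u.support ∪ (e i).1 := by
      ext j; simp [indap]
      tauto
    refine ⟨?_, ?_⟩
    · rw [es]; exact Finset.subset_union_right
    · rw [es]
      refine Finset.union_subset (by exact_mod_cast hu) (h _ (e i).2.1).2.1
  have hdis : ∀ i j u, u ∈ S i → u ∈ S j → i = j := by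
    rintro i j u ⟨a1, a2⟩ ⟨b1, b2⟩
    have h1 := (h _ (e i).2.1).2.2.2 u.support (by rw [(e i).2.2]; exact a1) a2
    have h2 := (h _ (e j).2.1).2.2.2 u.support (by rw [(e j).2.2]; exact b1) b2
    apply e.injective
    apply Subtype.ext
    rw [← (e i).2.2, ← (e j).2.2, ← h1.2.1, ← h2.2.1]
  have hdec : IsStanleyDecomp K σ I w A := by
    refine ⟨?_, ?_, ?_⟩
    · intro i f _ hf
      have h1 : f * monomial (ind (e i).1) 1 = 0 := congrArg Subtype.val hf
      rcases mul_eq_zero.1 h1 with h1 | h1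
      · exact h1
      · simp at h1
    · intro i
      have h2 : (⨆ j, ⨆ (_ : j ≠ i), stanleySpace K σ I (w j) (A j)) ≤ D (S i)ᶜ := by
        refine iSup₂_le fun j hj => (hle j).trans ?_
        intro f hf
        rw [hD] at hf ⊢
        exact fun u hu hui => hj (hdis _ _ u (hf u hu) hui)
      refine Disjoint.mono (hle i) h2 ?_
      rw [Submodule.disjoint_def]
      intro f h1 h2
      rw [hD] at h1 h2
      apply Subtype.ext
      rw [ZeroMemClass.coe_zero, ← support_eq_empty]
      exact Finset.eq_empty_of_forall_notMem fun u hu => h2 u hu (h1 u hu)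
    · rw [eq_top_iff]
      intro f _
      have key : ∀ u (hu : P u.support), (⟨monomial u 1, hI1 u hu⟩ : I) ∈
          ⨆ i, stanleySpace K σ I (w i) (A i) := by
        intro u hu
        let i := e.symm ⟨lo u.support, (hJ _ hu).1, (hJ _ hu).2.1⟩
        have hi : e i = ⟨lo u.support, (hJ _ hu).1, (hJ _ hu).2.1⟩ := by simp [i]
        refine Submodule.mem_iSup_of_mem i (Submodule.subset_span ⟨u - ind (lo u.support), ?_, ?_⟩)
        · simp only [A, hi, (hJ _ hu).2.2]
          intro j hj
          apply (h _ hu).2.1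
          simp at hj ⊢
          omega
        · apply Subtype.ext
          simp only [w, hi, Submodule.coe_smul, smul_eq_mul, monomial_mul, mul_one]
          congr 1
          rw [tsub_add_cancel_of_le]
          intro j
          rw [indap]
          split_ifs with hj
          · have := (h _ hu).1 hj
            simp at this
            omega
          · omega
      have hf : f = ∑ u ∈ f.1.support.attach, (f.1.coeff u.1) •
          (⟨monomial u.1 1, hI1 u.1 (hI2 f.1 f.2 u.1 u.2)⟩ : I) := by
        apply Subtype.ext
        rw [AddSubmonoidClass.coe_finsetSum]
        conv_lhs => rw [f.1.as_sum]
        rw [← Finset.sum_attach]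
        refine Finset.sum_congr rfl fun u _ => ?_
        change _ = (f.1.coeff u.1) • (monomial u.1 (1:K))
        rw [smul_monomial, smul_eq_mul, mul_one]
      rw [hf]
      exact Submodule.sum_mem _ fun u _ => Submodule.smul_mem _ _ (key _ (hI2 f.1 f.2 u.1 u.2))
  have hmem : sInf (Set.range fun i => (A i).card) ∈ { d | ∃ r, ∃ w : Fin r → I,
      ∃ A : Fin r → Finset σ,
      IsStanleyDecomp K σ I w A ∧ d = sInf (Set.range fun i => (A i).card) } :=
    ⟨r, w, A, hdec, rfl⟩
  have hbdd : BddAbove { d | ∃ r, ∃ w : Fin r → I, ∃ A : Fin r → Finset σ,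
      IsStanleyDecomp K σ I w A ∧ d = sInf (Set.range fun i => (A i).card) } := by
    refine ⟨Fintype.card σ, ?_⟩
    rintro _ ⟨r, w, A, -, rfl⟩
    rcases Nat.eq_zero_or_pos r with rfl | hr
    · simp
    · exact (Nat.sInf_le (Set.mem_range_self (⟨0, hr⟩ : Fin r))).trans (Finset.card_le_univ _)
  refine le_trans ?_ (le_csSup hbdd hmem)
  obtain ⟨s, hs⟩ := hPne
  let j : Fin r := e.symm ⟨lo s, (hJ _ hs).1, (hJ _ hs).2.1⟩
  refine le_csInf (Set.range_nonempty_iff_nonempty.2 ⟨j⟩) ?_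
  rintro _ ⟨i, rfl⟩
  exact (h _ (e i).2.1).2.2.1

/-- Let `n ≥ 5` and `3 ≤ l ≤ n − 2`. Then `sdepth_{R_l}(L_l) ≥ ⌈(l+2)/3⌉ + 1`. -/
theorem sdepth_Ll_ge (K : Type) [Field K] (n l : ℕ) (hn : 5 ≤ n) (hl : 3 ≤ l)
    (hln : l ≤ n - 2) :
    sdepth K (RlVars n l) (Ll K n l) ≥ (l + 4) / 3 + 1 := by
  classical
  have : Finite {k : ℕ // n - l - 1 ≤ k ∧ k ≤ n} :=
    Set.Finite.to_subtype (Set.finite_Icc (n - l - 1) n)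
  have : Finite (RlVars n l) := by unfold RlVars; infer_instance
  have : Fintype (RlVars n l) := Fintype.ofFinite _
  let y (c : Fin 2) : ℕ → RlVars n l := fun i =>
    if hi : i < l - 1 then Sum.inl (⟨n - l + 2 + i, by omega, by omega⟩, c) else Sum.inr ()
  have hy : ∀ c i (hi : i < l - 1), y c i = Sum.inl (⟨n - l + 2 + i, by omega, by omega⟩, c) := by
    intro c i hi; exact dif_pos hi
  have hyi : ∀ c c', ∀ i < l - 1, ∀ j < l - 1, y c i = y c' j → i = j ∧ c = c' := by
    intro c c' i hi j hj he
    rw [hy c i hi, hy c' j hj] at he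
    have h1 := Sum.inl.inj he
    have h2 := congrArg Subtype.val (Prod.mk.inj h1).1
    simp at h2
    exact ⟨h2, (Prod.mk.inj h1).2⟩
  let P : Finset (RlVars n l) → Prop := fun s =>
    (∃ v ∈ s, (∀ i < l - 1, v ≠ y 0 i) ∧ (∀ i < l - 1, v ≠ y 1 i)) ∨
      (∃ i, i + 1 < l - 1 ∧ y 0 i ∈ s ∧ y 0 (i+1) ∈ s) ∨
      (∃ i, i + 1 < l - 1 ∧ y 1 i ∈ s ∧ y 1 (i+1) ∈ s)
  have hPmono : ∀ s t, s ⊆ t → P s → P t := by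
    rintro s t hst (⟨v, h1, h2⟩ | ⟨i, h1, h2, h3⟩ | ⟨i, h1, h2, h3⟩)
    · exact Or.inl ⟨v, hst h1, h2⟩
    · exact Or.inr (Or.inl ⟨i, h1, hst h2, hst h3⟩)
    · exact Or.inr (Or.inr ⟨i, h1, hst h2, hst h3⟩)
  obtain ⟨lo, hi, h⟩ := union_part (l - 1) (by omega) (y 0) (y 1)
    (fun i hi j hj e => (hyi 0 0 i hi j hj e).1) (fun i hi j hj e => (hyi 1 1 i hi j hj e).1)
    (fun i hi j hj e => by have := (hyi 0 1 i hi j hj e).2; simp at this) P (fun s => Iff.rfl)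
  have hd : (l + 4) / 3 + 1 = (l - 1 + 2) / 3 + 2 := by omega
  rw [ge_iff_le, hd]
  have one : ∀ (u : RlVars n l →₀ ℕ) a, a ∈ u.support →
      (X a : MvPolynomial (RlVars n l) K) ∣ monomial u 1 := by
    intro u a ha
    rw [X_dvd_monomial]
    right
    simpa using ha
  have two : ∀ (u : RlVars n l →₀ ℕ) a b, a ≠ b → a ∈ u.support → b ∈ u.support →
      (X a * X b : MvPolynomial (RlVars n l) K) ∣ monomial u 1 := by
    intro u a b hab ha hb
    refine ⟨monomial (u - (Finsupp.single a 1 + Finsupp.single b 1)) 1, ?_⟩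
    rw [X, X, monomial_mul, monomial_mul, add_tsub_cancel_of_le]
    · simp
    · intro j
      simp only [Finsupp.mem_support_iff] at ha hb
      simp only [Finsupp.add_apply, Finsupp.single_apply]
      by_cases h1 : a = j <;> by_cases h2 : b = j <;> simp [h1, h2] <;> grind
  refine sdepth_ge_aux (Ll K n l) P ⟨{Sum.inr ()}, Or.inl ⟨Sum.inr (), Finset.mem_singleton_self _, ?_, ?_⟩⟩
    ?_ ?_ lo hi _ h
  · intro i hi; rw [hy 0 i hi]; exact fun h => by cases h
  · intro i hi; rw [hy 1 i hi]; exact fun h => by cases h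
  · rintro u (⟨v, h1, h2, h3⟩ | ⟨i, h1, h2, h3⟩ | ⟨i, h1, h2, h3⟩)
    · refine Ideal.mem_of_dvd _ (one u v h1) (Ideal.subset_span ?_)
      rcases v with ⟨a, c⟩ | ⟨⟩
      · left; right
        refine ⟨a, ?_, ?_⟩
        · by_contra hcon
          have ha := a.2
          have hlt : (a : ℕ) - (n - l + 2) < l - 1 := by omega
          have ea : a = ⟨n - l + 2 + ((a : ℕ) - (n - l + 2)), by omega, by omega⟩ :=
            Subtype.ext (by simp only; omega)
          rcases (by omega : c = 0 ∨ c = 1) with rfl | rfl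
          · apply h2 _ hlt
            rw [hy _ _ hlt, ← ea]
          · apply h3 _ hlt
            rw [hy _ _ hlt, ← ea]
        · rcases (by omega : c = 0 ∨ c = 1) with rfl | rfl
          · exact Or.inl rfl
          · exact Or.inr rfl
      · right; rfl
    · refine Ideal.mem_of_dvd _ (two u _ _ (fun e => by
        have := (hyi _ _ _ (by omega) _ h1 e).1; omega) h2 h3) (Ideal.subset_span ?_)
      rw [hy _ i (by omega), hy _ _ h1]
      left; left
      exact ⟨_, _, by simp only; omega, by simp only; omega, Or.inl rfl⟩
    · refine Ideal.mem_of_dvd _ (two u _ _ (fun e => by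
        have := (hyi _ _ _ (by omega) _ h1 e).1; omega) h2 h3) (Ideal.subset_span ?_)
      rw [hy _ i (by omega), hy _ _ h1]
      left; left
      exact ⟨_, _, by simp only; omega, by simp only; omega, Or.inr rfl⟩
  · have hup : IsUpperSet {u : RlVars n l →₀ ℕ | P u.support} := by
      intro u v huv hu
      exact hPmono _ _ (Finsupp.support_mono huv) hu
    have hV : ∀ v : RlVars n l, P {v} →
        (X v : MvPolynomial (RlVars n l) K) ∈ restrictSupportIdeal (R := K) _ hup := by
      intro v hv w hw
      have := support_monomial_subset hw
      rw [Finset.mem_singleton] at this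
      subst this
      change P _
      rwa [Finsupp.support_single_ne_zero _ one_ne_zero]
    have hE : ∀ a b : RlVars n l, P {a, b} →
        (X a * X b : MvPolynomial (RlVars n l) K) ∈ restrictSupportIdeal (R := K) _ hup := by
      intro a b hv w hw
      rw [X, X, monomial_mul] at hw
      have := support_monomial_subset hw
      rw [Finset.mem_singleton] at this
      subst this
      refine hPmono _ _ ?_ hv
      intro j hj
      simp only [Finset.mem_insert, Finset.mem_singleton] at hj
      rcases hj with rfl | rfl <;> simp
    have hle : Ll K n l ≤ restrictSupportIdeal (R := K) _ hup := by
      refine Ideal.span_le.2 ?_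
      rintro p ((⟨a, b, h1, h2, h3⟩ | ⟨a, h1, h2⟩) | h1)
      · have hb := b.2
        have hlt : (a : ℕ) - (n - l + 2) + 1 < l - 1 := by omega
        have ea : ∀ c, y c ((a : ℕ) - (n - l + 2)) = Sum.inl (a, c) := by
          intro c
          rw [hy _ _ (by omega)]
          congr 2
          apply Subtype.ext; simp only; omega
        have eb : ∀ c, y c ((a : ℕ) - (n - l + 2) + 1) = Sum.inl (b, c) := by
          intro c
          rw [hy _ _ (by omega)]
          congr 2
          apply Subtype.ext; simp only; omega
        rcases h3 with rfl | rfl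
        · apply hE
          refine Or.inr (Or.inl ⟨_, hlt, ?_, ?_⟩)
          · exact Finset.mem_insert.2 (Or.inl (ea _))
          · exact Finset.mem_insert.2 (Or.inr (Finset.mem_singleton.2 (eb _)))
        · apply hE
          refine Or.inr (Or.inr ⟨_, hlt, ?_, ?_⟩)
          · exact Finset.mem_insert.2 (Or.inl (ea _))
          · exact Finset.mem_insert.2 (Or.inr (Finset.mem_singleton.2 (eb _)))
      · have key : ∀ c c', ∀ i < l - 1, (Sum.inl (a, c) : RlVars n l) ≠ y c' i := by
          intro c c' i hi e
          rw [hy _ _ hi] at e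
          have := congrArg Subtype.val (Prod.mk.inj (Sum.inl.inj e)).1
          simp only at this
          omega
        rcases h2 with rfl | rfl
        · exact hV _ (Or.inl ⟨_, Finset.mem_singleton_self _, key _ _, key _ _⟩)
        · exact hV _ (Or.inl ⟨_, Finset.mem_singleton_self _, key _ _, key _ _⟩)
      · have h1 := Set.mem_singleton_iff.1 h1
        subst h1
        refine hV _ (Or.inl ⟨_, Finset.mem_singleton_self _, ?_, ?_⟩)
        · intro i hi; rw [hy 0 i hi]; exact fun h => by cases h
        · intro i hi; rw [hy 1 i hi]; exact fun h => by cases h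
    intro f hf u hu
    exact hle hf hu
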